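/- The group G = IMG(z²+i) has the L-presentation ⟨a, b, c | φⁿ(a²), φⁿ((ac)⁴), φⁿ([c,ab]²), φⁿ([c,bab]²), φⁿ([c,ababa]²), φⁿ([c,ababab]²), φⁿ([c,bababab]²), n ≥ 0⟩: the homomorphism from the free group on {a, b, c} to Perm({0,1}*) sending the generators to the tree automorphisms a, b, c is surjective onto G and its kernel equals the normal closure of the set {φⁿ(a²), φⁿ((ac)⁴), φⁿ([c,ab]²), φⁿ([c,bab]²), φⁿ([c,ababa]²), φⁿ([c,ababab]²), φⁿ([c,bababab]²) : n ≥ 0}. -/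

import Mathlib

/-- The tree automorphism `a` as a function: flips the first letter. -/
def aFun : List Bool → List Bool
  | [] => []
  | x :: w => (!x) :: w

mutual
  /-- The tree automorphism `b` as a function. -/
  def bFun : List Bool → List Bool
    | [] => []
    | false :: w => false :: aFun w
    | true :: w => true :: cFun w
  /-- The tree automorphism `c` as a function. -/
  def cFun : List Bool → List Bool
    | [] => []
    | false :: w => false :: bFun w
    | true :: w => true :: w
end

theorem aFun_involutive : Function.Involutive aFun := by
  intro w
  cases w with
  | nil => rfl
  | cons x t => cases x <;> rfl

theorem bcFun_involutive : ∀ w, bFun (bFun w) = w ∧ cFun (cFun w) = w := by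
  intro w
  induction w with
  | nil => exact ⟨rfl, rfl⟩
  | cons x t ih =>
    cases x
    · exact ⟨by simp [bFun, aFun_involutive t], by simp [cFun, ih.1]⟩
    · exact ⟨by simp [bFun, ih.2], by simp [cFun]⟩

/-- The tree automorphism `a` of the binary rooted tree `{0,1}*`. -/
def treeA : Equiv.Perm (List Bool) := Function.Involutive.toPerm aFun aFun_involutive

/-- The tree automorphism `b` of the binary rooted tree `{0,1}*`. -/
def treeB : Equiv.Perm (List Bool) :=
  Function.Involutive.toPerm bFun (fun w => (bcFun_involutive w).1)

/-- The tree automorphism `c` of the binary rooted tree `{0,1}*`. -/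
def treeC : Equiv.Perm (List Bool) :=
  Function.Involutive.toPerm cFun (fun w => (bcFun_involutive w).2)

/-- The group `G = IMG(z²+i)`, the subgroup of `Perm({0,1}*)` generated by `a`, `b`, `c`. -/
def IMG : Subgroup (Equiv.Perm (List Bool)) := Subgroup.closure {treeA, treeB, treeC}

/-- The commutator `[x, y] = x⁻¹y⁻¹xy`. -/
def commElt {M : Type*} [Group M] (x y : M) : M := x⁻¹ * y⁻¹ * x * y

/-- The substitution `φ : a ↦ b, b ↦ c, c ↦ aba` as an endomorphism of the free group on
`{a, b, c}` (with `a = 0`, `b = 1`, `c = 2`). -/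
def phiSub : FreeGroup (Fin 3) →* FreeGroup (Fin 3) :=
  FreeGroup.lift ![FreeGroup.of 1, FreeGroup.of 2,
    FreeGroup.of 0 * FreeGroup.of 1 * FreeGroup.of 0]

/-- The seven basic relators `a²`, `(ac)⁴`, `[c,ab]²`, `[c,bab]²`, `[c,ababa]²`,
`[c,ababab]²`, `[c,bababab]²` in the free group on `{a, b, c}`. -/
def Lrel : Fin 7 → FreeGroup (Fin 3) := fun j =>
  let fa := FreeGroup.of (0 : Fin 3)
  let fb := FreeGroup.of (1 : Fin 3)
  let fc := FreeGroup.of (2 : Fin 3)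
  ![fa ^ 2,
    (fa * fc) ^ 4,
    commElt fc (fa * fb) ^ 2,
    commElt fc (fb * fa * fb) ^ 2,
    commElt fc (fa * fb * fa * fb * fa) ^ 2,
    commElt fc (fa * fb * fa * fb * fa * fb) ^ 2,
    commElt fc (fb * fa * fb * fa * fb * fa * fb) ^ 2] j

/-- The homomorphism from the free group on `{a, b, c}` to `Perm({0,1}*)` sending the
generators to the tree automorphisms `a`, `b`, `c`. -/
def rhoHom : FreeGroup (Fin 3) →* Equiv.Perm (List Bool) :=
  FreeGroup.lift ![treeA, treeB, treeC]

/-- The wreath product `H ≀ C₂`: an element has two sections, indexed by the first letter, and a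
switch telling whether the two subtrees are exchanged. -/
@[ext]
structure BinaryWreath (H : Type*) where
  sec : Bool → H
  switch : Bool

namespace BinaryWreath

variable {H H' : Type*} [Group H] [Group H']

instance : Mul (BinaryWreath H) :=
  ⟨fun g h => ⟨fun x => g.sec (xor x h.switch) * h.sec x, xor g.switch h.switch⟩⟩

instance : One (BinaryWreath H) := ⟨⟨fun _ => 1, false⟩⟩

instance : Inv (BinaryWreath H) := ⟨fun g => ⟨fun x => (g.sec (xor x g.switch))⁻¹, g.switch⟩⟩

@[simp] theorem mul_sec (g h : BinaryWreath H) (x : Bool) :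
    (g * h).sec x = g.sec (xor x h.switch) * h.sec x := rfl

@[simp] theorem mul_switch (g h : BinaryWreath H) :
    (g * h).switch = xor g.switch h.switch := rfl

@[simp] theorem one_sec (x : Bool) : (1 : BinaryWreath H).sec x = 1 := rfl

@[simp] theorem one_switch : (1 : BinaryWreath H).switch = false := rfl

@[simp] theorem inv_sec (g : BinaryWreath H) (x : Bool) :
    g⁻¹.sec x = (g.sec (xor x g.switch))⁻¹ := rfl

@[simp] theorem inv_switch (g : BinaryWreath H) : g⁻¹.switch = g.switch := rfl

instance : Group (BinaryWreath H) :=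
  Group.ofLeftAxioms
    (fun f g h => by ext <;> simp [mul_assoc, Bool.xor_comm g.switch])
    (fun f => by ext <;> simp)
    (fun f => by ext <;> simp)

/-- The homomorphism of wreath products induced by a homomorphism of the base groups. -/
def map (f : H →* H') : BinaryWreath H →* BinaryWreath H' where
  toFun g := ⟨fun x => f (g.sec x), g.switch⟩
  map_one' := by ext <;> simp
  map_mul' g h := by ext <;> simp

@[simp] theorem map_sec (f : H →* H') (g : BinaryWreath H) (x : Bool) :
    (map f g).sec x = f (g.sec x) := rfl

@[simp] theorem map_switch (f : H →* H') (g : BinaryWreath H) :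
    (map f g).switch = g.switch := rfl

end BinaryWreath

namespace IMGPresentation

/-- The wreath recursion `a = σ`, `b = (a, c)`, `c = (b, 1)` on the free group. -/
def wreathRec : FreeGroup (Fin 3) →* BinaryWreath (FreeGroup (Fin 3)) :=
  FreeGroup.lift ![⟨fun _ => 1, true⟩,
    ⟨fun x => cond x (FreeGroup.of 2) (FreeGroup.of 0), false⟩,
    ⟨fun x => cond x 1 (FreeGroup.of 1), false⟩]

theorem rhoHom_nil (w : FreeGroup (Fin 3)) : rhoHom w [] = [] := by
  induction w using FreeGroup.induction_on with
  | C1 => simp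
  | of i => fin_cases i <;> rfl
  | inv_of i _ => fin_cases i <;> rfl
  | mul x y hx hy => rw [map_mul, Equiv.Perm.mul_apply, hy, hx]

theorem rhoHom_of_cons (i : Fin 3) (x : Bool) (v : List Bool) :
    rhoHom (FreeGroup.of i) (x :: v) =
      xor x (wreathRec (FreeGroup.of i)).switch ::
        rhoHom ((wreathRec (FreeGroup.of i)).sec x) v := by
  have hA (w : List Bool) : treeA w = aFun w := rfl
  have hB (w : List Bool) : treeB w = bFun w := rfl
  have hC (w : List Bool) : treeC w = cFun w := rfl
  fin_cases i <;> cases x <;> simp [rhoHom, wreathRec, hA, hB, hC, aFun, bFun, cFun]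

theorem rhoHom_cons (w : FreeGroup (Fin 3)) : ∀ (x : Bool) (v : List Bool),
    rhoHom w (x :: v) = xor x (wreathRec w).switch :: rhoHom ((wreathRec w).sec x) v := by
  induction w using FreeGroup.induction_on with
  | C1 => simp
  | of i => exact rhoHom_of_cons i
  | inv_of i _ =>
    intro x v
    rw [map_inv, Equiv.Perm.inv_eq_iff_eq, rhoHom_of_cons]
    simp [map_inv]
  | mul y z hy hz =>
    intro x v
    rw [map_mul, Equiv.Perm.mul_apply, hz, hy]
    simp [Bool.xor_comm (wreathRec y).switch, Equiv.Perm.mul_apply]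

/-- The relators of the `L`-presentation. -/
def relators : Set (FreeGroup (Fin 3)) := {x | ∃ (n : ℕ) (j : Fin 7), x = (⇑phiSub)^[n] (Lrel j)}

/-- The group defined by the `L`-presentation. -/
abbrev LGroup : Type := PresentedGroup relators

/-- The generator `a` of `LGroup`. -/
def genA : LGroup := PresentedGroup.of 0

/-- The generator `b` of `LGroup`. -/
def genB : LGroup := PresentedGroup.of 1

/-- The generator `c` of `LGroup`. -/
def genC : LGroup := PresentedGroup.of 2

theorem mk_of_zero : PresentedGroup.mk relators (FreeGroup.of 0) = genA := rfl

theorem mk_of_one : PresentedGroup.mk relators (FreeGroup.of 1) = genB := rfl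

theorem mk_of_two : PresentedGroup.mk relators (FreeGroup.of 2) = genC := rfl

theorem mk_iterate_phiSub_Lrel (n : ℕ) (j : Fin 7) :
    PresentedGroup.mk relators ((⇑phiSub)^[n] (Lrel j)) = 1 :=
  PresentedGroup.one_of_mem ⟨n, j, rfl⟩

@[simp] theorem phiSub_of_zero : phiSub (FreeGroup.of 0) = FreeGroup.of 1 := rfl

@[simp] theorem phiSub_of_one : phiSub (FreeGroup.of 1) = FreeGroup.of 2 := rfl

@[simp] theorem phiSub_of_two : phiSub (FreeGroup.of 2) =
    FreeGroup.of 0 * FreeGroup.of 1 * FreeGroup.of 0 := by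
  simp [phiSub]

@[simp] theorem genA_mul_self : genA * genA = 1 := by
  simpa [Lrel, mk_of_zero, pow_two] using mk_iterate_phiSub_Lrel 0 0

@[simp] theorem genB_mul_self : genB * genB = 1 := by
  simpa [Lrel, mk_of_one, pow_two] using mk_iterate_phiSub_Lrel 1 0

@[simp] theorem genC_mul_self : genC * genC = 1 := by
  simpa [Lrel, mk_of_two, pow_two] using mk_iterate_phiSub_Lrel 2 0

@[simp] theorem genA_inv : genA⁻¹ = genA := inv_eq_of_mul_eq_one_left genA_mul_self

@[simp] theorem genB_inv : genB⁻¹ = genB := inv_eq_of_mul_eq_one_left genB_mul_self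

@[simp] theorem genC_inv : genC⁻¹ = genC := inv_eq_of_mul_eq_one_left genC_mul_self

@[simp] theorem genA_mul_cancel (x : LGroup) : genA * (genA * x) = x := by
  rw [← mul_assoc, genA_mul_self, one_mul]

@[simp] theorem genB_mul_cancel (x : LGroup) : genB * (genB * x) = x := by
  rw [← mul_assoc, genB_mul_self, one_mul]

@[simp] theorem genC_mul_cancel (x : LGroup) : genC * (genC * x) = x := by
  rw [← mul_assoc, genC_mul_self, one_mul]

theorem genA_mul_genC_pow : (genA * genC) ^ 4 = 1 := by
  simpa [Lrel, mk_of_zero, mk_of_two] using mk_iterate_phiSub_Lrel 0 1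

theorem genA_mul_genB_pow : (genA * genB) ^ 8 = 1 := by
  have h : (genB * (genA * genB * genA)) ^ 4 = 1 := by
    simpa [Lrel, mk_of_zero, mk_of_one] using mk_iterate_phiSub_Lrel 1 1
  have h' : (genA * genB) ^ 8 = genA * (genB * (genA * genB * genA)) ^ 4 * genA⁻¹ := by
    simp [pow_succ, mul_assoc]
  rw [h', h]
  simp

/-- The relation `(ab)⁴ = (ba)⁴`, in a form suited to rewriting right-associated products. -/
theorem genA_genB_braid (x : LGroup) :
    genA * (genB * (genA * (genB * (genA * (genB * (genA * (genB * x))))))) =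
      genB * (genA * (genB * (genA * (genB * (genA * (genB * (genA * x))))))) := by
  have h : (genA * genB) ^ 4 = ((genA * genB) ^ 4)⁻¹ := by
    rw [eq_inv_iff_mul_eq_one, ← pow_add, genA_mul_genB_pow]
  have h' := congrArg (· * x) h
  simpa [pow_succ, mul_assoc] using h'

theorem map_commElt {M M' : Type*} [Group M] [Group M'] (f : M →* M') (x y : M) :
    f (commElt x y) = commElt (f x) (f y) := by simp [commElt]

@[simp] theorem commElt_one_left {M : Type*} [Group M] (x : M) : commElt 1 x = 1 := by
  simp [commElt]

@[simp] theorem commElt_one_right {M : Type*} [Group M] (x : M) : commElt x 1 = 1 := by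
  simp [commElt]

@[simp] theorem commElt_self {M : Type*} [Group M] (x : M) : commElt x x = 1 := by
  simp [commElt]

theorem lift_iterate_phiSub_Lrel (n : ℕ) (j : Fin 7) :
    FreeGroup.lift ![genC, 1, genA] ((⇑phiSub)^[n] (Lrel j)) = 1 ∧
    FreeGroup.lift ![1, genA, 1] ((⇑phiSub)^[n] (Lrel j)) = 1 ∧
    FreeGroup.lift ![genA, 1, genA] ((⇑phiSub)^[n] (Lrel j)) = 1 := by
  induction n with
  | zero =>
    have h : (genC * genA) ^ 4 = 1 := by
      have := congrArg (fun x => genC * x * genC⁻¹) genA_mul_genC_pow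
      simpa [pow_succ, mul_assoc] using this
    have hcomm : commElt genA genC ^ 2 = 1 := by
      rw [← genA_mul_genC_pow]
      simp [commElt, pow_succ, mul_assoc]
    fin_cases j <;> simp [Lrel, map_commElt, h, hcomm, pow_two genA, pow_two genC]
  | succ n ih =>
    have e1 : (FreeGroup.lift ![genC, 1, genA]).comp phiSub = FreeGroup.lift ![1, genA, 1] := by
      ext i; fin_cases i <;> simp
    have e2 : (FreeGroup.lift ![1, genA, 1]).comp phiSub = FreeGroup.lift ![genA, 1, genA] := by
      ext i; fin_cases i <;> simp
    have e3 : (FreeGroup.lift ![genA, 1, genA]).comp phiSub = FreeGroup.lift ![1, genA, 1] := by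
      ext i; fin_cases i <;> simp
    rw [Function.iterate_succ_apply', ← MonoidHom.comp_apply, ← MonoidHom.comp_apply,
      ← MonoidHom.comp_apply, e1, e2, e3]
    exact ⟨ih.2.1, ih.2.2, ih.2.1⟩

/-- The wreath recursion with sections taken in `LGroup`. -/
def wreathMk : FreeGroup (Fin 3) →* BinaryWreath LGroup :=
  (BinaryWreath.map (PresentedGroup.mk relators)).comp wreathRec

@[simp] theorem wreathMk_of_zero : wreathMk (FreeGroup.of 0) = ⟨fun _ => 1, true⟩ := by
  ext <;> simp [wreathMk, wreathRec]

@[simp] theorem wreathMk_of_one :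
    wreathMk (FreeGroup.of 1) = ⟨fun x => cond x genC genA, false⟩ := by
  ext x
  · cases x <;> simp [wreathMk, wreathRec, mk_of_zero, mk_of_two]
  · simp [wreathMk, wreathRec]

@[simp] theorem wreathMk_of_two : wreathMk (FreeGroup.of 2) = ⟨fun x => cond x 1 genB, false⟩ := by
  ext x
  · cases x <;> simp [wreathMk, wreathRec, mk_of_one]
  · simp [wreathMk, wreathRec]

theorem wreathMk_phiSub (w : FreeGroup (Fin 3)) :
    (wreathMk (phiSub w)).switch = false ∧
    (wreathMk (phiSub w)).sec false = PresentedGroup.mk relators w ∧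
    (wreathMk (phiSub w)).sec true = FreeGroup.lift ![genC, 1, genA] w := by
  have hof (i : Fin 3) : (wreathMk (phiSub (FreeGroup.of i))).switch = false ∧
      (wreathMk (phiSub (FreeGroup.of i))).sec false = PresentedGroup.mk relators (FreeGroup.of i) ∧
      (wreathMk (phiSub (FreeGroup.of i))).sec true =
        FreeGroup.lift ![genC, 1, genA] (FreeGroup.of i) := by
    fin_cases i <;> simp [mk_of_zero, mk_of_one, mk_of_two]
  induction w using FreeGroup.induction_on with
  | C1 => simp
  | of i => exact hof i
  | inv_of i _ =>
    obtain ⟨h1, h2, h3⟩ := hof i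
    simp only [map_inv, BinaryWreath.inv_switch, BinaryWreath.inv_sec, h1, Bool.xor_false, h2, h3,
      and_self]
  | mul x y hx hy =>
    obtain ⟨h1, h2, h3⟩ := hx
    obtain ⟨h4, h5, h6⟩ := hy
    simp only [map_mul, BinaryWreath.mul_switch, BinaryWreath.mul_sec, h1, h2, h3, h4, h5, h6,
      Bool.xor_false, and_self]

theorem wreathMk_iterate_phiSub_Lrel (n : ℕ) (j : Fin 7) :
    wreathMk ((⇑phiSub)^[n] (Lrel j)) = 1 := by
  cases n with
  | zero =>
    have hcomm (g : BinaryWreath LGroup) (hg : g.switch = true) :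
        commElt (⟨fun x => cond x 1 genB, false⟩ : BinaryWreath LGroup) g ^ 2 = 1 := by
      ext x
      · cases x <;> simp [commElt, pow_two, mul_assoc, hg]
      · simp [commElt, pow_two]
    fin_cases j
    · ext <;> simp [Lrel, pow_two]
    · ext x
      · cases x <;> simp [Lrel, pow_succ]
      · simp [Lrel, pow_succ]
    all_goals simp [Lrel, map_commElt, hcomm]
  | succ n =>
    rw [Function.iterate_succ_apply']
    obtain ⟨h1, h2, h3⟩ := wreathMk_phiSub ((⇑phiSub)^[n] (Lrel j))
    ext x
    · cases x
      · rw [h2, mk_iterate_phiSub_Lrel, BinaryWreath.one_sec]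
      · rw [h3, (lift_iterate_phiSub_Lrel n j).1, BinaryWreath.one_sec]
    · exact h1

/-- The wreath recursion on `LGroup`. -/
def wreath : LGroup →* BinaryWreath LGroup :=
  QuotientGroup.lift _ wreathMk <| Subgroup.normalClosure_le_normal <| by
    rintro _ ⟨n, j, rfl⟩
    exact wreathMk_iterate_phiSub_Lrel n j

theorem wreath_mk (w : FreeGroup (Fin 3)) :
    wreath (PresentedGroup.mk relators w) = wreathMk w := rfl

/-- The endomorphism of `LGroup` induced by the substitution. -/
def phi : LGroup →* LGroup :=
  QuotientGroup.lift _ ((PresentedGroup.mk relators).comp phiSub) <|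
    Subgroup.normalClosure_le_normal <| by
      rintro _ ⟨n, j, rfl⟩
      have h := mk_iterate_phiSub_Lrel (n + 1) j
      rwa [Function.iterate_succ_apply'] at h

theorem phi_mk (w : FreeGroup (Fin 3)) :
    phi (PresentedGroup.mk relators w) = PresentedGroup.mk relators (phiSub w) := rfl

@[simp] theorem phi_genA : phi genA = genB := rfl

@[simp] theorem phi_genB : phi genB = genC := rfl

@[simp] theorem phi_genC : phi genC = genA * genB * genA := by
  rw [← mk_of_two, phi_mk, phiSub_of_two]; rfl

@[simp] theorem wreath_genA : wreath genA = ⟨fun _ => 1, true⟩ := wreathMk_of_zero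

@[simp] theorem wreath_genC : wreath genC = ⟨fun x => cond x 1 genB, false⟩ := wreathMk_of_two

theorem wreath_phi (g : LGroup) :
    (wreath (phi g)).switch = false ∧ (wreath (phi g)).sec false = g := by
  obtain ⟨w, rfl⟩ := PresentedGroup.mk_surjective relators g
  rw [phi_mk, wreath_mk]
  exact ⟨(wreathMk_phiSub w).1, (wreathMk_phiSub w).2.1⟩

theorem commute_genC_conj {x : LGroup} (h : commElt genC x ^ 2 = 1) :
    Commute genC (x⁻¹ * genC * x) := by
  have hy : (x⁻¹ * genC * x)⁻¹ = x⁻¹ * genC * x := by simp [mul_assoc]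
  have h' : genC * (x⁻¹ * genC * x) * (genC * (x⁻¹ * genC * x)) = 1 := by
    simpa [commElt, pow_two, mul_assoc] using h
  have := eq_inv_of_mul_eq_one_left h'
  rwa [mul_inv_rev, hy, genC_inv] at this

theorem commute_genC_conj_inv {x : LGroup} (h : Commute genC (x⁻¹ * genC * x)) :
    Commute genC (x * genC * x⁻¹) := by
  have h' := h.conj x
  simpa [mul_assoc] using h'.symm

/-- The dihedral subgroup generated by `b` and `aba`. -/
def dihedral : Subgroup LGroup := Subgroup.closure {genB, genA * genB * genA}

/-- The elements of the group `⟨a, b⟩` in which the letter `a` occurs an odd number of times. -/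
def oddWords : Set LGroup :=
  {genA, genA * genB, genB * genA, genB * (genA * genB),
    genA * (genB * (genA * (genB * genA))),
    genA * (genB * (genA * (genB * (genA * genB)))),
    genB * (genA * (genB * (genA * (genB * genA)))),
    genB * (genA * (genB * (genA * (genB * (genA * genB)))))}

theorem mul_genA_mem_oddWords {d : LGroup} (hd : d ∈ dihedral) : d * genA ∈ oddWords := by
  have hbraid := genA_genB_braid 1
  simp only [mul_one] at hbraid
  have key : ∀ x ∈ ({genB, genA * genB * genA} : Set LGroup), ∀ y : LGroup,
      y * genA ∈ oddWords → x * y * genA ∈ oddWords := by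
    intro x hx y hy
    rw [mul_assoc]
    generalize y * genA = z at hy
    rcases hx with rfl | rfl <;>
    rcases hy with rfl | rfl | rfl | rfl | rfl | rfl | rfl | rfl <;>
    simp [oddWords, mul_assoc, genA_genB_braid, hbraid]
  induction hd using Subgroup.closure_induction_left with
  | one => simp [oddWords]
  | mul_left x hx y hy ih => exact key x hx y ih
  | inv_mul_cancel x hx y hy ih =>
    have hinv : x⁻¹ = x := by rcases hx with rfl | rfl <;> simp [mul_assoc]
    rw [hinv]
    exact key x hx y ih

theorem commute_genC_of_mem_dihedral {d : LGroup} (hd : d ∈ dihedral) :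
    Commute genC ((d * genA)⁻¹ * genC * (d * genA)) := by
  have hA : Commute genC (genA⁻¹ * genC * genA) := by
    apply commute_genC_conj
    have := congrArg (fun x => genC * x * genC⁻¹) genA_mul_genC_pow
    simpa [commElt, pow_succ, mul_assoc] using this
  have hAB : Commute genC ((genA * genB)⁻¹ * genC * (genA * genB)) := by
    apply commute_genC_conj
    simpa [Lrel, mk_of_zero, mk_of_one, mk_of_two, commElt, mul_assoc]
      using mk_iterate_phiSub_Lrel 0 2
  have hABABAB : Commute genC ((genA * (genB * (genA * (genB * (genA * genB)))))⁻¹ * genC *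
      (genA * (genB * (genA * (genB * (genA * genB)))))) := by
    apply commute_genC_conj
    simpa [Lrel, mk_of_zero, mk_of_one, mk_of_two, commElt, mul_assoc]
      using mk_iterate_phiSub_Lrel 0 5
  rcases mul_genA_mem_oddWords hd with h | h | h | h | h | h | h | h <;> rw [h]
  · exact hA
  · exact hAB
  · simpa [mul_assoc] using commute_genC_conj_inv hAB
  · apply commute_genC_conj
    simpa [Lrel, mk_of_zero, mk_of_one, mk_of_two, commElt, mul_assoc]
      using mk_iterate_phiSub_Lrel 0 3
  · apply commute_genC_conj
    simpa [Lrel, mk_of_zero, mk_of_one, mk_of_two, commElt, mul_assoc]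
      using mk_iterate_phiSub_Lrel 0 4
  · exact hABABAB
  · simpa [mul_assoc] using commute_genC_conj_inv hABABAB
  · apply commute_genC_conj
    simpa [Lrel, mk_of_zero, mk_of_one, mk_of_two, commElt, mul_assoc]
      using mk_iterate_phiSub_Lrel 0 6

/-- The subgroup generated by the conjugates of `c` under `⟨b, aba⟩`; it turns out to be normal in
the stabilizer of the first level. -/
def conjC : Subgroup LGroup := Subgroup.closure {x | ∃ d ∈ dihedral, x = d * genC * d⁻¹}

theorem genC_mem_conjC : genC ∈ conjC :=
  Subgroup.subset_closure ⟨1, one_mem _, by simp⟩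

theorem conj_mem_conjC_of_mem_dihedral {d k : LGroup} (hd : d ∈ dihedral) (hk : k ∈ conjC) :
    d * k * d⁻¹ ∈ conjC := by
  have : conjC ≤ conjC.comap (MulAut.conj d).toMonoidHom := by
    refine (Subgroup.closure_le _).2 ?_
    rintro _ ⟨e, he, rfl⟩
    exact Subgroup.subset_closure ⟨d * e, mul_mem hd he, by simp [mul_assoc]⟩
  simpa using this hk

theorem genB_mem_dihedral : genB ∈ dihedral := Subgroup.subset_closure (by simp)

theorem genA_genB_genA_mem_dihedral : genA * genB * genA ∈ dihedral :=
  Subgroup.subset_closure (by simp)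

theorem commute_of_mem_conjC {k : LGroup} (hk : k ∈ conjC) : Commute (genA * genC * genA) k := by
  have : conjC ≤ Subgroup.centralizer {genA * genC * genA} := by
    refine (Subgroup.closure_le _).2 ?_
    rintro _ ⟨d, hd, rfl⟩
    rw [SetLike.mem_coe, Subgroup.mem_centralizer_singleton_iff]
    have h := (commute_genC_of_mem_dihedral (inv_mem hd)).conj genA
    have h' : Commute (genA * genC * genA) (d * genC * d⁻¹) := by
      simpa [mul_assoc] using h
    exact h'.symm
  exact (Subgroup.mem_centralizer_singleton_iff.1 (this hk)).symm

theorem dihedral_le_range_phi : dihedral ≤ phi.range := by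
  refine (Subgroup.closure_le _).2 ?_
  rintro _ (rfl | rfl)
  · exact ⟨genA, phi_genA⟩
  · exact ⟨genC, phi_genC⟩

theorem conjC_le_range_phi : conjC ≤ phi.range := by
  refine (Subgroup.closure_le _).2 ?_
  rintro _ ⟨d, h, rfl⟩
  have hd := dihedral_le_range_phi h
  exact mul_mem (mul_mem hd ⟨genB, phi_genB⟩) (inv_mem hd)

theorem wreath_of_mem_conjC {k : LGroup} (hk : k ∈ conjC) :
    (wreath k).switch = false ∧ (wreath k).sec true = 1 := by
  have hdih : ∀ d ∈ dihedral, (wreath d).switch = false := by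
    intro d hd
    obtain ⟨g, rfl⟩ := dihedral_le_range_phi hd
    exact (wreath_phi g).1
  induction hk using Subgroup.closure_induction with
  | mem x hx =>
    obtain ⟨d, hd, rfl⟩ := hx
    simp [hdih d hd]
  | one => simp
  | mul x y _ _ hx hy => simp [hx, hy]
  | inv x _ hx => simp [hx]

/-- Every element is, up to the switch `a`, the product of a conjugate by `a` of an element of
`conjC` and of an element in the image of `phi`. -/
theorem exists_decomposition (g : LGroup) : ∃ k ∈ conjC, ∃ h : LGroup,
    g = genA * k * genA * phi h ∨ g = k * genA * phi h := by
  have key (i : Fin 3) (g : LGroup) (hg : ∃ k ∈ conjC, ∃ h : LGroup,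
      g = genA * k * genA * phi h ∨ g = k * genA * phi h) : ∃ k ∈ conjC, ∃ h : LGroup,
      PresentedGroup.of i * g = genA * k * genA * phi h ∨
        PresentedGroup.of i * g = k * genA * phi h := by
    obtain ⟨k, hk, h, hg⟩ := hg
    have hb := conj_mem_conjC_of_mem_dihedral genB_mem_dihedral hk
    have haba := conj_mem_conjC_of_mem_dihedral genA_genB_genA_mem_dihedral hk
    have hcomm := (commute_of_mem_conjC hk).eq
    fin_cases i
    · change ∃ k ∈ conjC, ∃ h : LGroup,
        genA * g = genA * k * genA * phi h ∨ genA * g = k * genA * phi h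
      rcases hg with rfl | rfl
      · exact ⟨k, hk, h, .inr (by simp [mul_assoc])⟩
      · exact ⟨k, hk, h, .inl (by simp [mul_assoc])⟩
    · change ∃ k ∈ conjC, ∃ h : LGroup,
        genB * g = genA * k * genA * phi h ∨ genB * g = k * genA * phi h
      rcases hg with rfl | rfl
      · exact ⟨_, haba, genA * h, .inl (by simp [mul_assoc])⟩
      · exact ⟨_, hb, genC * h, .inr (by simp [mul_assoc])⟩
    · change ∃ k ∈ conjC, ∃ h : LGroup,
        genC * g = genA * k * genA * phi h ∨ genC * g = k * genA * phi h
      rcases hg with rfl | rfl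
      · refine ⟨k, hk, genB * h, .inl ?_⟩
        have e : genC * (genA * k * genA * phi h) =
            genA * (genA * genC * genA * k) * genA * phi h := by simp [mul_assoc]
        rw [e, hcomm]
        simp [mul_assoc]
      · exact ⟨genC * k, mul_mem genC_mem_conjC hk, h, .inr (by simp [mul_assoc])⟩
  have hg : g ∈ Subgroup.closure (Set.range (PresentedGroup.of (rels := relators))) := by
    rw [PresentedGroup.closure_range_of]; trivial
  induction hg using Subgroup.closure_induction_left with
  | one => exact ⟨1, one_mem _, 1, .inl (by simp)⟩
  | mul_left x hx y _ ih =>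
    obtain ⟨i, rfl⟩ := hx
    exact key i y ih
  | inv_mul_cancel x hx y _ ih =>
    obtain ⟨i, rfl⟩ := hx
    have hinv : (PresentedGroup.of i : LGroup)⁻¹ = PresentedGroup.of i := by
      fin_cases i
      · exact genA_inv
      · exact genB_inv
      · exact genC_inv
    rw [hinv]
    exact key i y ih

theorem wreath_injective : Function.Injective wreath := by
  rw [injective_iff_map_eq_one]
  intro g hg
  obtain ⟨k, hk, h, rfl | rfl⟩ := exists_decomposition g
  · obtain ⟨hs, ht⟩ := wreath_of_mem_conjC hk
    obtain ⟨hs', ht'⟩ := wreath_phi h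
    have hh : h = 1 := by
      have := congrArg (fun x => BinaryWreath.sec x false) hg
      simpa [hs, ht, hs', ht'] using this
    subst hh
    have hk1 : wreath k = 1 := by
      have e : k = genA⁻¹ * (genA * k * genA * phi 1) * genA⁻¹ := by simp [mul_assoc]
      rw [e, map_mul, map_mul, hg]
      rw [mul_one, ← map_mul, genA_inv, genA_mul_self, map_one]
    obtain ⟨k', rfl⟩ := conjC_le_range_phi hk
    have hk' : k' = 1 := by
      rw [← (wreath_phi k').2, hk1, BinaryWreath.one_sec]
    simp [hk']
  · have := congrArg BinaryWreath.switch hg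
    simp [(wreath_of_mem_conjC hk).1, (wreath_phi h).1] at this

theorem rhoHom_eq_one_of_mk_eq_one {w : FreeGroup (Fin 3)}
    (hw : PresentedGroup.mk relators w = 1) : rhoHom w = 1 := by
  ext1 v
  rw [Equiv.Perm.one_apply]
  induction v generalizing w with
  | nil => exact rhoHom_nil w
  | cons x v ih =>
    have h : wreathMk w = 1 := by rw [← wreath_mk, hw, map_one]
    have hs : (wreathRec w).switch = false := congrArg BinaryWreath.switch h
    have hx : PresentedGroup.mk relators ((wreathRec w).sec x) = 1 :=
      congrArg (fun g => BinaryWreath.sec g x) h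
    rw [rhoHom_cons, hs, ih hx, Bool.xor_false]

theorem switch_and_sec_of_rhoHom_eq_one {w : FreeGroup (Fin 3)} (hw : rhoHom w = 1) :
    (wreathRec w).switch = false ∧ ∀ x, rhoHom ((wreathRec w).sec x) = 1 := by
  have h (x : Bool) (v : List Bool) := rhoHom_cons w x v
  simp only [hw, Equiv.Perm.one_apply, List.cons.injEq] at h
  refine ⟨?_, fun x => ?_⟩
  · simpa using (h false []).1.symm
  · ext1 v
    exact (h x v).2.symm

/-- The element of the free group given by a word in the generators. -/
def word (l : List (Fin 3)) : FreeGroup (Fin 3) := (l.map FreeGroup.of).prod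

@[simp] theorem word_nil : word [] = 1 := rfl

@[simp] theorem word_cons (i : Fin 3) (l : List (Fin 3)) :
    word (i :: l) = FreeGroup.of i * word l := by simp [word]

theorem exists_word (g : LGroup) : ∃ l, PresentedGroup.mk relators (word l) = g := by
  obtain ⟨w, rfl⟩ := PresentedGroup.mk_surjective relators g
  induction w using FreeGroup.induction_on with
  | C1 => exact ⟨[], by simp⟩
  | of i => exact ⟨[i], by simp⟩
  | inv_of i _ =>
    refine ⟨[i], ?_⟩
    rw [map_inv, word_cons, word_nil, mul_one]
    fin_cases i
    · exact genA_inv.symm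
    · exact genB_inv.symm
    · exact genC_inv.symm
  | mul x y hx hy =>
    obtain ⟨l, hl⟩ := hx
    obtain ⟨m, hm⟩ := hy
    exact ⟨l ++ m, by rw [map_mul, ← hl, ← hm, ← map_mul]; simp [word]⟩

/-- Sections of a word do not get longer, and get shorter by the number of letters `a`. -/
theorem exists_word_sec (l : List (Fin 3)) : ∀ x : Bool, ∃ m : List (Fin 3),
    word m = (wreathRec (word l)).sec x ∧ m.length + l.count 0 ≤ l.length := by
  induction l with
  | nil => exact fun x => ⟨[], by simp, by simp⟩
  | cons i l ih =>
    intro x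
    obtain ⟨m, hm, hlen⟩ := ih x
    rw [word_cons, map_mul, BinaryWreath.mul_sec, ← hm]
    generalize xor x (wreathRec (word l)).switch = y
    fin_cases i
    · exact ⟨m, by simp [wreathRec], by simp; omega⟩
    · cases y
      · exact ⟨0 :: m, by simp [wreathRec], by simp; omega⟩
      · exact ⟨2 :: m, by simp [wreathRec], by simp; omega⟩
    · cases y
      · exact ⟨1 :: m, by simp [wreathRec], by simp; omega⟩
      · exact ⟨m, by simp [wreathRec], by simp; omega⟩

/-- A word without the letter `a` is the image under the substitution of a word of the same length
in the letters `a` and `b`. -/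
theorem exists_word_phiSub {l : List (Fin 3)} (hl : 0 ∉ l) : ∃ m : List (Fin 3),
    phiSub (word m) = word l ∧ m.length = l.length ∧ 2 ∉ m ∧ (2 ∉ l → 1 ∉ m) := by
  induction l with
  | nil => exact ⟨[], by simp⟩
  | cons i l ih =>
    obtain ⟨m, hm, hlen, h2, h1⟩ := ih (fun h => hl (List.mem_cons_of_mem _ h))
    fin_cases i
    · simp at hl
    · exact ⟨0 :: m, by simp [hm], by simp [hlen], by simpa using h2, by simpa using h1⟩
    · exact ⟨1 :: m, by simp [hm], by simp [hlen], by simpa using h2, by simp⟩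

theorem rhoHom_eq_one_of_phiSub {w : FreeGroup (Fin 3)} (hw : rhoHom (phiSub w) = 1) :
    rhoHom w = 1 := by
  have h : (wreathRec (phiSub w)).switch = false ∧ (wreathRec (phiSub w)).sec false = w := by
    clear hw
    induction w using FreeGroup.induction_on with
    | C1 => simp
    | of i => fin_cases i <;> simp [wreathRec]
    | inv_of i h => simp only [map_inv, BinaryWreath.inv_switch, BinaryWreath.inv_sec, h,
        Bool.xor_false, and_self]
    | mul x y hx hy => simp only [map_mul, BinaryWreath.mul_switch, BinaryWreath.mul_sec, hx, hy,
        Bool.xor_false, and_self]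
  simpa only [h.2] using (switch_and_sec_of_rhoHom_eq_one hw).2 false

theorem mk_word_eq_one (l : List (Fin 3)) (hl : rhoHom (word l) = 1) :
    PresentedGroup.mk relators (word l) = 1 := by
  have main (N : ℕ) : ∀ l : List (Fin 3), l.length = N → rhoHom (word l) = 1 →
      PresentedGroup.mk relators (word l) = 1 := by
    induction N using Nat.strong_induction_on with
    | _ N ih =>
    have hmem (l : List (Fin 3)) (hN : l.length = N) (hl : rhoHom (word l) = 1) (h0 : 0 ∈ l) :
        PresentedGroup.mk relators (word l) = 1 := by
      obtain ⟨hs, hx⟩ := switch_and_sec_of_rhoHom_eq_one hl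
      apply wreath_injective
      rw [wreath_mk, map_one]
      ext x
      · obtain ⟨m, hm, hlen⟩ := exists_word_sec l x
        have hpos := List.count_pos_iff.2 h0
        have := ih m.length (by omega) m rfl (hm ▸ hx x)
        rw [hm] at this
        exact this
      · exact hs
    have hphi (l m : List (Fin 3)) (hm : phiSub (word m) = word l)
        (h : PresentedGroup.mk relators (word m) = 1) :
        PresentedGroup.mk relators (word l) = 1 := by
      rw [← hm, ← phi_mk, h, map_one]
    intro l hN hl
    by_cases h0 : 0 ∈ l
    · exact hmem l hN hl h0
    obtain ⟨m, hm, hlen, h2, -⟩ := exists_word_phiSub h0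
    refine hphi l m hm ?_
    have hρm := rhoHom_eq_one_of_phiSub (hm ▸ hl)
    by_cases h0m : 0 ∈ m
    · exact hmem m (by omega) hρm h0m
    obtain ⟨k, hk, hlenk, h2k, h1k⟩ := exists_word_phiSub h0m
    refine hphi m k hk ?_
    by_cases h0k : 0 ∈ k
    · exact hmem k (by omega) (rhoHom_eq_one_of_phiSub (hk ▸ hρm)) h0k
    have hnil : k = [] := by
      rw [List.eq_nil_iff_forall_not_mem]
      intro i hi
      fin_cases i
      · exact h0k hi
      · exact h1k h2 hi
      · exact h2k hi
    simp [hnil]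
  exact main _ l rfl hl

end IMGPresentation

/-- the L-presentation of `G = IMG(z²+i)`: the homomorphism
`FreeGroup{a,b,c} → Perm({0,1}*)` is surjective onto `G` and its kernel is the normal
closure of the iterated images under `φ` of the seven basic relators. -/
theorem IMG_L_presentation :
    MonoidHom.range rhoHom = IMG ∧
      MonoidHom.ker rhoHom = Subgroup.normalClosure
        {x : FreeGroup (Fin 3) | ∃ (n : ℕ) (j : Fin 7), x = (⇑phiSub)^[n] (Lrel j)} := by
  refine ⟨?_, ?_⟩
  · rw [rhoHom, FreeGroup.range_lift_eq_closure, IMG, Matrix.range_cons, Matrix.range_cons,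
      Matrix.range_cons, Matrix.range_empty, Set.union_empty]
    rfl
  · ext w
    change rhoHom w = 1 ↔ w ∈ Subgroup.normalClosure IMGPresentation.relators
    rw [← QuotientGroup.eq_one_iff]
    refine ⟨fun hw => ?_, IMGPresentation.rhoHom_eq_one_of_mk_eq_one⟩
    obtain ⟨l, hl⟩ :=
      IMGPresentation.exists_word (PresentedGroup.mk IMGPresentation.relators w)
    have hlw : rhoHom ((IMGPresentation.word l)⁻¹ * w) = 1 :=
      IMGPresentation.rhoHom_eq_one_of_mk_eq_one (by rw [map_mul, map_inv, hl, inv_mul_cancel])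
    rw [map_mul, hw, mul_one, map_inv, inv_eq_one] at hlw
    exact hl.symm.trans (IMGPresentation.mk_word_eq_one l hlw)
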